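/- For two orthonormal bases (α₁,…,αₙ) and (β₁,…,βₙ) of an n-dimensional complex Hilbert space, there exists a unique finest pair of partitions {I₁,…,I_m} and {J₁,…,J_m} of {1,…,n} such that span{αᵢ : i ∈ I_k} = span{β_j : j ∈ J_k} for all k; that is, any other pair of partitions satisfying this span condition is coarser than this pair. -/

import Mathlib

open Submodule

/-- `I` is a partition of `Fin n` into `m` (nonempty, pairwise disjoint, covering) blocks. -/
def IsPartition {n m : ℕ} (I : Fin m → Finset (Fin n)) : Prop :=
  (∀ k, (I k).Nonempty) ∧ (∀ k l, k ≠ l → Disjoint (I k) (I l)) ∧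
  Finset.univ.biUnion I = Finset.univ

/-- The span condition pairing block `I k` with block `J k`. -/
def SpanCond {n m : ℕ} {H : Type*} [NormedAddCommGroup H] [InnerProductSpace ℂ H]
    (α β : OrthonormalBasis (Fin n) ℂ H) (I J : Fin m → Finset (Fin n)) : Prop :=
  ∀ k, Submodule.span ℂ ((fun i => α i) '' (I k : Set (Fin n))) =
       Submodule.span ℂ ((fun j => β j) '' (J k : Set (Fin n)))

/-- `(I, J)` (with `m` blocks) is finer than `(I', J')` (with `m'` blocks): every block of
`I` is contained in a block of `I'`, and the corresponding `J`-block in the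
corresponding `J'`-block. -/
def FinerPair {n m m' : ℕ} (I J : Fin m → Finset (Fin n))
    (I' J' : Fin m' → Finset (Fin n)) : Prop :=
  ∃ f : Fin m → Fin m', ∀ k, I k ⊆ I' (f k) ∧ J k ⊆ J' (f k)

/-- Membership of an index in a block of a partition. -/
theorem IsPartition.exists_mem {n m : ℕ} {I : Fin m → Finset (Fin n)} (hI : IsPartition I)
    (i : Fin n) : ∃ k, i ∈ I k := by
  have h : i ∈ Finset.univ.biUnion I := hI.2.2 ▸ Finset.mem_univ i
  simpa using h

/-- Two blocks of a partition sharing an element are the same block. -/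
theorem IsPartition.eq_of_mem {n m : ℕ} {I : Fin m → Finset (Fin n)} (hI : IsPartition I)
    {i : Fin n} {k l : Fin m} (hk : i ∈ I k) (hl : i ∈ I l) : k = l := by
  by_contra h
  exact Finset.disjoint_left.mp (hI.2.1 k l h) hk hl

/-- The fibers of a map onto `Q`, enumerated by `Fin m`, form a partition. -/
theorem isPartition_fibers {n m : ℕ} {Q : Type*} [DecidableEq Q] (e : Fin m ≃ Q)
    {f : Fin n → Q} (hf : Function.Surjective f) :
    IsPartition fun k => Finset.univ.filter fun i => f i = e k := by
  refine ⟨fun k => ?_, fun k l hkl => ?_, ?_⟩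
  · obtain ⟨i, hi⟩ := hf (e k)
    exact ⟨i, by simpa using hi⟩
  · rw [Finset.disjoint_left]
    intro i hi hi'
    simp only [Finset.mem_filter, Finset.mem_univ, true_and] at hi hi'
    exact hkl (e.injective (hi.symm.trans hi'))
  · ext i
    simpa using ⟨e.symm (f i), by simp⟩

section OrthonormalBases

variable {n : ℕ} {H : Type*} [NormedAddCommGroup H] [InnerProductSpace ℂ H]

/-- The span of a subfamily of `α` lies in that of a subfamily of `β` as soon as the former
is orthogonal to all remaining vectors of `β`. -/
theorem span_image_le_of_inner_eq_zero (α β : OrthonormalBasis (Fin n) ℂ H)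
    {I J : Finset (Fin n)} (h : ∀ i ∈ I, ∀ j, j ∉ J → inner ℂ (β j) (α i) = 0) :
    span ℂ ((fun i => α i) '' (I : Set (Fin n))) ≤
      span ℂ ((fun j => β j) '' (J : Set (Fin n))) := by
  rw [span_le]
  rintro _ ⟨i, hi, rfl⟩
  simp only [SetLike.mem_coe]
  rw [← β.sum_repr' (α i)]
  refine sum_mem fun j _ => ?_
  by_cases hj : j ∈ J
  · exact smul_mem _ _ (subset_span ⟨j, hj, rfl⟩)
  · rw [h i hi j hj, zero_smul]
    exact zero_mem _

/-- A vector of `β` not orthogonal to some element of the span of a subfamily of `β` belongs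
to that subfamily. -/
theorem mem_of_inner_ne_zero_of_mem_span (β : OrthonormalBasis (Fin n) ℂ H)
    {J : Finset (Fin n)} {x : H} (hx : x ∈ span ℂ ((fun j => β j) '' (J : Set (Fin n))))
    {j : Fin n} (hj : inner ℂ (β j) x ≠ 0) : j ∈ J := by
  by_contra hmem
  refine hj ?_
  induction hx using span_induction with
  | mem x hx =>
    obtain ⟨l, hl, rfl⟩ := hx
    exact β.orthonormal.2 fun h => hmem (h ▸ hl)
  | zero => exact inner_zero_right _
  | add x y _ _ ihx ihy => rw [inner_add_right]; by_contra h; simp_all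
  | smul a x _ ih => rw [inner_smul_right]; by_contra h; simp_all

/-- Every vector of `α` is non-orthogonal to some vector of `β`. -/
theorem exists_inner_ne_zero (α β : OrthonormalBasis (Fin n) ℂ H) (i : Fin n) :
    ∃ j, inner ℂ (β j) (α i) ≠ 0 := by
  by_contra! h
  apply α.orthonormal.ne_zero i
  rw [← β.sum_repr' (α i)]
  exact Finset.sum_eq_zero fun j _ => by rw [h j, zero_smul]

/-- The bipartite relation linking `α i` with `β j` when they are not orthogonal. -/
inductive Linked (α β : OrthonormalBasis (Fin n) ℂ H) : Fin n ⊕ Fin n → Fin n ⊕ Fin n → Prop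
  | of_inner_ne_zero (i j : Fin n) (h : inner ℂ (β j) (α i) ≠ 0) :
    Linked α β (Sum.inl i) (Sum.inr j)

/-- The component of the vector `α i`. -/
def leftComponent (α β : OrthonormalBasis (Fin n) ℂ H) (i : Fin n) : Quot (Linked α β) :=
  Quot.mk _ (Sum.inl i)

/-- The component of the vector `β j`. -/
def rightComponent (α β : OrthonormalBasis (Fin n) ℂ H) (j : Fin n) : Quot (Linked α β) :=
  Quot.mk _ (Sum.inr j)

theorem leftComponent_eq_rightComponent (α β : OrthonormalBasis (Fin n) ℂ H) {i j : Fin n}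
    (h : inner ℂ (β j) (α i) ≠ 0) : leftComponent α β i = rightComponent α β j :=
  Quot.sound (.of_inner_ne_zero i j h)

theorem leftComponent_surjective (α β : OrthonormalBasis (Fin n) ℂ H) :
    Function.Surjective (leftComponent α β) := by
  rintro ⟨i | j⟩
  · exact ⟨i, rfl⟩
  · obtain ⟨i, hi⟩ := exists_inner_ne_zero β α j
    exact ⟨i, leftComponent_eq_rightComponent α β fun h => hi (inner_eq_zero_symm.mp h)⟩

theorem rightComponent_surjective (α β : OrthonormalBasis (Fin n) ℂ H) :
    Function.Surjective (rightComponent α β) := by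
  rintro ⟨i | j⟩
  · obtain ⟨j, hj⟩ := exists_inner_ne_zero α β i
    exact ⟨j, (leftComponent_eq_rightComponent α β hj).symm⟩
  · exact ⟨j, rfl⟩

open Classical in
theorem spanCond_components {m : ℕ} (α β : OrthonormalBasis (Fin n) ℂ H)
    (e : Fin m ≃ Quot (Linked α β)) :
    SpanCond α β (fun k => Finset.univ.filter fun i => leftComponent α β i = e k)
      (fun k => Finset.univ.filter fun j => rightComponent α β j = e k) := by
  intro k
  refine le_antisymm (span_image_le_of_inner_eq_zero α β fun i hi j hj => ?_)
    (span_image_le_of_inner_eq_zero β α fun j hj i hi => ?_)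
  · simp only [Finset.mem_filter, Finset.mem_univ, true_and] at hi hj
    by_contra h
    exact hj ((leftComponent_eq_rightComponent α β h).symm.trans hi)
  · simp only [Finset.mem_filter, Finset.mem_univ, true_and] at hi hj
    by_contra h
    exact hi ((leftComponent_eq_rightComponent α β
      fun h' => h (inner_eq_zero_symm.mp h')).trans hj)

open Classical in
theorem finerPair_components {m m' : ℕ} (α β : OrthonormalBasis (Fin n) ℂ H)
    (e : Fin m ≃ Quot (Linked α β)) {I' J' : Fin m' → Finset (Fin n)}
    (hI : IsPartition I') (hJ : IsPartition J') (hspan : SpanCond α β I' J') :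
    FinerPair (fun k => Finset.univ.filter fun i => leftComponent α β i = e k)
      (fun k => Finset.univ.filter fun j => rightComponent α β j = e k) I' J' := by
  choose a ha using hI.exists_mem
  choose b hb using hJ.exists_mem
  have hab : ∀ x y, Linked α β x y → Sum.elim a b x = Sum.elim a b y := by
    rintro _ _ ⟨i, j, hij⟩
    have hi : α i ∈ span ℂ ((fun j => β j) '' (J' (a i) : Set (Fin n))) :=
      hspan (a i) ▸ subset_span ⟨i, ha i, rfl⟩
    exact hJ.eq_of_mem (mem_of_inner_ne_zero_of_mem_span β hi hij) (hb j)
  refine ⟨fun k => Quot.lift (Sum.elim a b) hab (e k), fun k => ⟨fun i hi => ?_, fun j hj => ?_⟩⟩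
  · simp only [Finset.mem_filter, Finset.mem_univ, true_and] at hi
    beta_reduce
    rw [← hi]
    exact ha i
  · simp only [Finset.mem_filter, Finset.mem_univ, true_and] at hj
    beta_reduce
    rw [← hj]
    exact hb j

end OrthonormalBases

/-- Of two pairs of partitions finer than each other, the blocks of one are blocks of the
other. -/
theorem range_subset_of_finerPair {n m₁ m₂ : ℕ} {I₁ J₁ : Fin m₁ → Finset (Fin n)}
    {I₂ J₂ : Fin m₂ → Finset (Fin n)} (hI : IsPartition I₁)
    (h₁ : FinerPair I₁ J₁ I₂ J₂) (h₂ : FinerPair I₂ J₂ I₁ J₁) :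
    Set.range (fun k => (I₁ k, J₁ k)) ⊆ Set.range (fun k => (I₂ k, J₂ k)) := by
  obtain ⟨f, hf⟩ := h₁
  obtain ⟨g, hg⟩ := h₂
  rintro _ ⟨k, rfl⟩
  obtain ⟨i, hi⟩ := hI.1 k
  have hgf : g (f k) = k := hI.eq_of_mem ((hg (f k)).1 ((hf k).1 hi)) hi
  have hgk := hg (f k)
  rw [hgf] at hgk
  exact ⟨f k, Prod.ext (hgk.1.antisymm (hf k).1) (hgk.2.antisymm (hf k).2)⟩

/-- Existence and uniqueness of the finest pair of partitions with matching spans: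
there is a pair finer than every pair satisfying the span condition, and any two such
finest pairs coincide (as sets of paired blocks). -/
theorem stmt2 {n : ℕ} (hn : 1 ≤ n)
    {H : Type*} [NormedAddCommGroup H] [InnerProductSpace ℂ H]
    [FiniteDimensional ℂ H] (hdim : Module.finrank ℂ H = n)
    (α β : OrthonormalBasis (Fin n) ℂ H) :
    (∃ m : ℕ, m ≤ n ∧ ∃ I J : Fin m → Finset (Fin n),
      IsPartition I ∧ IsPartition J ∧ SpanCond α β I J ∧
      (∀ (m' : ℕ) (I' J' : Fin m' → Finset (Fin n)),
        IsPartition I' → IsPartition J' → SpanCond α β I' J' → FinerPair I J I' J')) ∧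
    (∀ (m₁ m₂ : ℕ) (I₁ J₁ : Fin m₁ → Finset (Fin n)) (I₂ J₂ : Fin m₂ → Finset (Fin n)),
      IsPartition I₁ → IsPartition J₁ → SpanCond α β I₁ J₁ →
      IsPartition I₂ → IsPartition J₂ → SpanCond α β I₂ J₂ →
      (∀ (m' : ℕ) (I' J' : Fin m' → Finset (Fin n)),
        IsPartition I' → IsPartition J' → SpanCond α β I' J' → FinerPair I₁ J₁ I' J') →
      (∀ (m' : ℕ) (I' J' : Fin m' → Finset (Fin n)),
        IsPartition I' → IsPartition J' → SpanCond α β I' J' → FinerPair I₂ J₂ I' J') →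
      Set.range (fun k => (I₁ k, J₁ k)) = Set.range (fun k => (I₂ k, J₂ k))) := by
  classical
  refine ⟨?_, ?_⟩
  · have : Finite (Quot (Linked α β)) := Finite.of_surjective _ (leftComponent_surjective α β)
    let e : Fin (Nat.card (Quot (Linked α β))) ≃ Quot (Linked α β) :=
      (Finite.equivFin _).symm
    refine ⟨Nat.card (Quot (Linked α β)), ?_, _, _,
      isPartition_fibers e (leftComponent_surjective α β),
      isPartition_fibers e (rightComponent_surjective α β), ?_, ?_⟩
    · simpa using Nat.card_le_card_of_surjective _ (leftComponent_surjective α β)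
    · convert spanCond_components α β e
    · intro m' I' J' hI hJ hspan
      convert finerPair_components α β e hI hJ hspan
  · intro m₁ m₂ I₁ J₁ I₂ J₂ hI₁ hJ₁ hs₁ hI₂ hJ₂ hs₂ hfin₁ hfin₂
    have h₁ := hfin₁ m₂ I₂ J₂ hI₂ hJ₂ hs₂
    have h₂ := hfin₂ m₁ I₁ J₁ hI₁ hJ₁ hs₁
    exact (range_subset_of_finerPair hI₁ h₁ h₂).antisymm (range_subset_of_finerPair hI₂ h₂ h₁)
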